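/- arXiv:2511.19186 — 5 statements merged into one kernel-verified Lean document; each statement's English description precedes it below -/
import Mathlib

section
/- Let T > 0 and let P, f̂, f̄ : [0,T] → ℝ be continuous functions with f̂(T) = 0. Assume that (1 − P(t)·f̂(t))·f̄(t) = f̂(t) for every t ∈ [0,T] such that 1 − P(t)·f̂(t) ≠ 0. Then 1 − P(t)·f̂(t) > 0 for every t ∈ [0,T]. (Positivity claim of Theorem 4 of the paper, proved by showing that the closed set 𝒯 = {t ∈ [0,T] : 1 − P(t)f̂(t) = 0} is empty and then using the intermediate value theorem.) -/
/-- Positivity claim of Theorem 4 of the paper: if `P`, `f̂`, `f̄` are continuous on `[0,T]`,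
`f̂(T) = 0`, and `(1 − P f̂)·f̄ = f̂` holds wherever `1 − P f̂ ≠ 0`, then `1 − P(t)f̂(t) > 0`
for every `t ∈ [0,T]`. -/
theorem stmt_4 (T : ℝ) (hT : 0 < T) (P fhat fbar : ℝ → ℝ)
    (hP : ContinuousOn P (Set.Icc 0 T))
    (hf : ContinuousOn fhat (Set.Icc 0 T))
    (hfb : ContinuousOn fbar (Set.Icc 0 T))
    (hfT : fhat T = 0)
    (hrel : ∀ t ∈ Set.Icc (0:ℝ) T, 1 - P t * fhat t ≠ 0 →
      (1 - P t * fhat t) * fbar t = fhat t) :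
    ∀ t ∈ Set.Icc (0:ℝ) T, 0 < 1 - P t * fhat t := by
  intro t ht
  by_contra! hneg
  have hg : ContinuousOn (fun x => 1 - P x * fhat x) (Set.Icc 0 T) :=
    continuousOn_const.sub (hP.mul hf)
  have hgh : ContinuousOn (fun x => (1 - P x * fhat x) * (1 + P x * fbar x)) (Set.Icc 0 T) :=
    hg.mul (continuousOn_const.add (hP.mul hfb))
  obtain ⟨s, hs, hs0⟩ : (0 : ℝ) ∈ (fun x => 1 - P x * fhat x) '' Set.Icc t T :=
    intermediate_value_Icc ht.2 (hg.mono (Set.Icc_subset_Icc_left ht.1))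
      ⟨hneg, by simp [hfT]⟩
  have hs0' : 1 - P s * fhat s = 0 := hs0
  have hs_nonneg : 0 ≤ s := ht.1.trans hs.1
  have eq_one : ∀ x ∈ Set.Icc (0 : ℝ) T, 1 - P x * fhat x ≠ 0 →
      (1 - P x * fhat x) * (1 + P x * fbar x) = 1 := fun x hx hne => by
    linear_combination P x * hrel x hx hne
  have hT1 := eq_one T ⟨hT.le, le_rfl⟩ (by simp [hfT])
  obtain ⟨r, hr, hr_half⟩ :
      (1 / 2 : ℝ) ∈ (fun x => (1 - P x * fhat x) * (1 + P x * fbar x)) '' Set.Icc s T := by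
    refine intermediate_value_Icc hs.2 (hgh.mono (Set.Icc_subset_Icc_left hs_nonneg)) ⟨?_, ?_⟩
    · simp only [hs0', zero_mul]
      norm_num
    · simp only [hT1]
      norm_num
  have hr_half' : (1 - P r * fhat r) * (1 + P r * fbar r) = 1 / 2 := hr_half
  by_cases hr0 : 1 - P r * fhat r = 0
  · norm_num [hr0] at hr_half'
  · have := eq_one r ⟨hs_nonneg.trans hr.1, hr.2⟩ hr0
    linarith
end

section
/- Market coefficients as in the context. Let f̂, P : [0,T] → ℝ be differentiable and suppose: (i) f̂ solves f̂′(t) + [ (1−δ)·uᵀΘ̂⁻¹u + σ_Y² ]·f̂(t)² + 2·[ (1−δ)·uᵀΘ̂⁻¹a + λ ]·f̂(t) + (1−δ)·aᵀΘ̂⁻¹a = 0 on [0,T]; (ii) P solves P′(t) = 2λ·P(t) + σ_Y² − p(t)ᵀ(Σ̃_SΣ̃_Sᵀ)⁻¹p(t) on [0,T], where p(t) := u + P(t)·a ∈ ℝⁿ; (iii) 1 − P(t)·f̂(t) > 0 on [0,T]. Then the function f̄(t) := f̂(t)/(1 − P(t)·f̂(t)) solves on [0,T] the partial-information Riccati equation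 f̄′(t) + [ (1−δ)·p(t)ᵀΘ̂⁻¹p(t) + p(t)ᵀ(Σ̃_SΣ̃_Sᵀ)⁻¹p(t) ]·f̄(t)² + 2·[ (1−δ)·p(t)ᵀΘ̂⁻¹a + λ ]·f̄(t) + (1−δ)·aᵀΘ̂⁻¹a = 0, and if moreover f̂(T) = 0 then f̄(T) = 0. (Relation (5.19) of Theorem 4 of the paper.) -/
open Matrix

/-- Expansion of the quadratic form of a symmetric matrix along a line. -/
theorem dotProduct_mulVec_add_smul_self {n : ℕ} {M : Matrix (Fin n) (Fin n) ℝ} (hM : Mᵀ = M)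
    (u a : Fin n → ℝ) (c : ℝ) :
    (u + c • a) ⬝ᵥ (M *ᵥ (u + c • a)) =
      u ⬝ᵥ (M *ᵥ u) + 2 * c * (u ⬝ᵥ (M *ᵥ a)) + c ^ 2 * (a ⬝ᵥ (M *ᵥ a)) := by
  have hsymm : a ⬝ᵥ (M *ᵥ u) = u ⬝ᵥ (M *ᵥ a) := by
    rw [dotProduct_mulVec, ← mulVec_transpose, hM, dotProduct_comm]
  simp only [mulVec_add, mulVec_smul, dotProduct_add, add_dotProduct, smul_dotProduct,
    dotProduct_smul, smul_eq_mul, hsymm]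
  ring

/-- Relation (5.19) of Theorem 4: if `f̂` solves the full-information Riccati equation, `P`
solves the filter variance equation, and `1 − P f̂ > 0` on `[0,T]`, then
`f̄ = f̂/(1 − P f̂)` solves the partial-information Riccati equation, with `f̄(T) = 0`
whenever `f̂(T) = 0`.  Here `p(t) = u + P(t)·a` is the transposed Kalman gain. -/
theorem stmt_5 (n : ℕ) (a u : Fin n → ℝ) (σY lam δ : ℝ)
    (hδ : 0 < δ) (hδ1 : δ ≠ 1)
    (S Θ : Matrix (Fin n) (Fin n) ℝ) (hS : IsUnit S.det) (hΘ : Θ.PosDef)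
    (T : ℝ) (fhat P : ℝ → ℝ)
    (hf : ∀ t ∈ Set.Icc (0:ℝ) T,
      HasDerivAt fhat
        (-(((1 - δ) * (u ⬝ᵥ (Θ⁻¹ *ᵥ u)) + σY ^ 2) * fhat t ^ 2 +
            2 * ((1 - δ) * (u ⬝ᵥ (Θ⁻¹ *ᵥ a)) + lam) * fhat t +
            (1 - δ) * (a ⬝ᵥ (Θ⁻¹ *ᵥ a)))) t)
    (hP : ∀ t ∈ Set.Icc (0:ℝ) T,
      HasDerivAt P
        (2 * lam * P t + σY ^ 2 -
          ((u + P t • a) ⬝ᵥ ((S * Sᵀ)⁻¹ *ᵥ (u + P t • a)))) t)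
    (hpos : ∀ t ∈ Set.Icc (0:ℝ) T, 0 < 1 - P t * fhat t) :
    (∀ t ∈ Set.Icc (0:ℝ) T,
      HasDerivAt (fun s => fhat s / (1 - P s * fhat s))
        (-(((1 - δ) * ((u + P t • a) ⬝ᵥ (Θ⁻¹ *ᵥ (u + P t • a))) +
              ((u + P t • a) ⬝ᵥ ((S * Sᵀ)⁻¹ *ᵥ (u + P t • a)))) *
              (fhat t / (1 - P t * fhat t)) ^ 2 +
            2 * ((1 - δ) * ((u + P t • a) ⬝ᵥ (Θ⁻¹ *ᵥ a)) + lam) *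
              (fhat t / (1 - P t * fhat t)) +
            (1 - δ) * (a ⬝ᵥ (Θ⁻¹ *ᵥ a)))) t) ∧
    (fhat T = 0 → fhat T / (1 - P T * fhat T) = 0) := by
  refine ⟨fun t ht => ?_, fun h => by rw [h, zero_div]⟩
  have hsymm : Θ⁻¹ᵀ = Θ⁻¹ := hΘ.isHermitian.inv
  have hD : 1 - P t * fhat t ≠ 0 := (hpos t ht).ne'
  refine ((hf t ht).fun_div (((hP t ht).fun_mul (hf t ht)).const_sub 1) hD).congr_deriv ?_
  rw [dotProduct_mulVec_add_smul_self hsymm u a (P t),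
    add_dotProduct u (P t • a) (Θ⁻¹ *ᵥ a), smul_dotProduct, smul_eq_mul]
  generalize (u + P t • a) ⬝ᵥ ((S * Sᵀ)⁻¹ *ᵥ (u + P t • a)) = q
  rw [mul_comm (P t) (fhat t)] at hD ⊢
  field_simp
  ring
end

section
/- Market coefficients as in the context. Let f̂, ĝ, P : [0,T] → ℝ be differentiable and suppose: (i) f̂ solves f̂′ + [ (1−δ)·uᵀΘ̂⁻¹u + σ_Y² ]·f̂² + 2[ (1−δ)·uᵀΘ̂⁻¹a + λ ]·f̂ + (1−δ)·aᵀΘ̂⁻¹a = 0; (ii) ĝ solves ĝ′ + [ (1−δ)·uᵀΘ̂⁻¹a + λ ]·ĝ + [ (1−δ)·uᵀΘ̂⁻¹(b−rₙ) + β ]·f̂ + [ (1−δ)·uᵀΘ̂⁻¹u + σ_Y² ]·f̂·ĝ + (1−δ)·aᵀΘ̂⁻¹(b−rₙ) = 0; (iii) P solves P′ = 2λP + σ_Y² − p(t)ᵀ(Σ̃_SΣ̃_Sᵀ)⁻¹p(t) with p(t) := u + P(t)·a; (iv) 1 − P(t)·f̂(t) > 0 on [0,T]. Then, with f̄ :=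 f̂/(1 − Pf̂), the function ḡ(t) := ĝ(t)/(1 − P(t)·f̂(t)) solves on [0,T] the equation ḡ′ + [ (1−δ)·p(t)ᵀΘ̂⁻¹a + λ ]·ḡ + [ (1−δ)·p(t)ᵀΘ̂⁻¹(b−rₙ) + β ]·f̄ + [ (1−δ)·p(t)ᵀΘ̂⁻¹p(t) + p(t)ᵀ(Σ̃_SΣ̃_Sᵀ)⁻¹p(t) ]·f̄·ḡ + (1−δ)·aᵀΘ̂⁻¹(b−rₙ) = 0, and if ĝ(T) = 0 then ḡ(T) = 0. (Relation (5.20) of Theorem 4 of the paper.) -/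
open Matrix

/-- The bilinear form of a symmetric matrix is symmetric. -/
theorem Matrix.IsSymm.dotProduct_mulVec_comm {ι : Type*} [Fintype ι] {M : Matrix ι ι ℝ}
    (hM : M.IsSymm) (v w : ι → ℝ) : v ⬝ᵥ (M *ᵥ w) = w ⬝ᵥ (M *ᵥ v) := by
  rw [dotProduct_mulVec, ← mulVec_transpose, hM.eq, dotProduct_comm]

/-- Relation (5.20) of Theorem 4: with `f̂, ĝ` solving the full-information ODE system, `P`
the filter variance and `1 − P f̂ > 0`, the function `ḡ = ĝ/(1 − P f̂)` solves the
partial-information linear ODE (with `f̄ = f̂/(1 − P f̂)` and `p(t) = u + P(t)·a`), and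
`ḡ(T) = 0` whenever `ĝ(T) = 0`. -/
theorem stmt_6 (n : ℕ) (a b u : Fin n → ℝ) (r σY lam β δ : ℝ)
    (hδ : 0 < δ) (hδ1 : δ ≠ 1)
    (S Θ : Matrix (Fin n) (Fin n) ℝ) (hS : IsUnit S.det) (hΘ : Θ.PosDef)
    (T : ℝ) (fhat ghat P : ℝ → ℝ)
    (hf : ∀ t ∈ Set.Icc (0:ℝ) T,
      HasDerivAt fhat
        (-(((1 - δ) * (u ⬝ᵥ (Θ⁻¹ *ᵥ u)) + σY ^ 2) * fhat t ^ 2 +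
            2 * ((1 - δ) * (u ⬝ᵥ (Θ⁻¹ *ᵥ a)) + lam) * fhat t +
            (1 - δ) * (a ⬝ᵥ (Θ⁻¹ *ᵥ a)))) t)
    (hg : ∀ t ∈ Set.Icc (0:ℝ) T,
      HasDerivAt ghat
        (-(((1 - δ) * (u ⬝ᵥ (Θ⁻¹ *ᵥ a)) + lam) * ghat t +
            ((1 - δ) * (u ⬝ᵥ (Θ⁻¹ *ᵥ (b - r • (1 : Fin n → ℝ)))) + β) * fhat t +
            ((1 - δ) * (u ⬝ᵥ (Θ⁻¹ *ᵥ u)) + σY ^ 2) * fhat t * ghat t +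
            (1 - δ) * (a ⬝ᵥ (Θ⁻¹ *ᵥ (b - r • (1 : Fin n → ℝ)))))) t)
    (hP : ∀ t ∈ Set.Icc (0:ℝ) T,
      HasDerivAt P
        (2 * lam * P t + σY ^ 2 -
          ((u + P t • a) ⬝ᵥ ((S * Sᵀ)⁻¹ *ᵥ (u + P t • a)))) t)
    (hpos : ∀ t ∈ Set.Icc (0:ℝ) T, 0 < 1 - P t * fhat t) :
    (∀ t ∈ Set.Icc (0:ℝ) T,
      HasDerivAt (fun s => ghat s / (1 - P s * fhat s))
        (-(((1 - δ) * ((u + P t • a) ⬝ᵥ (Θ⁻¹ *ᵥ a)) + lam) *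
              (ghat t / (1 - P t * fhat t)) +
            ((1 - δ) * ((u + P t • a) ⬝ᵥ (Θ⁻¹ *ᵥ (b - r • (1 : Fin n → ℝ)))) + β) *
              (fhat t / (1 - P t * fhat t)) +
            ((1 - δ) * ((u + P t • a) ⬝ᵥ (Θ⁻¹ *ᵥ (u + P t • a))) +
                ((u + P t • a) ⬝ᵥ ((S * Sᵀ)⁻¹ *ᵥ (u + P t • a)))) *
              (fhat t / (1 - P t * fhat t)) * (ghat t / (1 - P t * fhat t)) +
            (1 - δ) * (a ⬝ᵥ (Θ⁻¹ *ᵥ (b - r • (1 : Fin n → ℝ)))))) t) ∧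
    (ghat T = 0 → ghat T / (1 - P T * fhat T) = 0) := by
  refine ⟨fun t ht => ?_, fun h => by rw [h, zero_div]⟩
  have hne : 1 - P t * fhat t ≠ 0 := (hpos t ht).ne'
  have hsymm : (Θ⁻¹).IsSymm := by
    simpa [IsHermitian, IsSymm, conjTranspose_eq_transpose_of_trivial] using hΘ.isHermitian.inv
  have hgbar := (hg t ht).div (((hP t ht).mul (hf t ht)).const_sub 1) hne
  refine hgbar.congr_deriv ?_
  generalize (u + P t • a) ⬝ᵥ ((S * Sᵀ)⁻¹ *ᵥ (u + P t • a)) = q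
  generalize b - r • (1 : Fin n → ℝ) = c
  simp only [Pi.mul_apply, mulVec_add, mulVec_smul, add_dotProduct, dotProduct_add,
    smul_dotProduct, dotProduct_smul, smul_eq_mul, hsymm.dotProduct_mulVec_comm a u]
  generalize hD : 1 - P t * fhat t = D at hne ⊢
  field_simp
  rw [← hD]
  ring
end

section
/- Market coefficients as in the context. Let P : [0,T] → ℝ be continuous, set p(t) := u + P(t)·a ∈ ℝⁿ, and let f̄, ḡ, h̄ : [0,T] → ℝ be differentiable solutions with f̄(T) = ḡ(T) = h̄(T) = 0 of the system: f̄′ + [ (1−δ)p(t)ᵀΘ̂⁻¹p(t) + p(t)ᵀ(Σ̃_SΣ̃_Sᵀ)⁻¹p(t) ]f̄² + 2[ (1−δ)p(t)ᵀΘ̂⁻¹a + λ ]f̄ + (1−δ)aᵀΘ̂⁻¹a = 0; ḡ′ + [ (1−δ)p(t)ᵀΘ̂⁻¹a + λ ]ḡ + [ (1−δ)p(t)ᵀΘ̂⁻¹(b−rₙ) + β ]f̄ + [ (1−δ)p(t)ᵀΘ̂⁻¹p(t) + p(t)ᵀ(Σ̃_SΣ̃_Sᵀ)⁻¹p(t)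 ]f̄ḡ + (1−δ)aᵀΘ̂⁻¹(b−rₙ) = 0; h̄′ + (1−δ)r + [ (1−δ)p(t)ᵀΘ̂⁻¹(b−rₙ) + β ]ḡ + (1/2)p(t)ᵀ(Σ̃_SΣ̃_Sᵀ)⁻¹p(t)·f̄ + (1/2)[ (1−δ)p(t)ᵀΘ̂⁻¹p(t) + p(t)ᵀ(Σ̃_SΣ̃_Sᵀ)⁻¹p(t) ]ḡ² + ((1−δ)/2)(b−rₙ)ᵀΘ̂⁻¹(b−rₙ) = 0. Define ψ(t,γ) = exp( (f̄(t)/2)·γ² + ḡ(t)·γ + h̄(t) ). Then ψ > 0, ψ(T,γ) = 1 for all γ ∈ ℝ, and for every (t,γ) ∈ [0,T] × ℝ: ∂_tψ + (1−δ)·r·ψ + ((1−δ)/2)·ψ·(a·γ + b − rₙ)ᵀΘ̂⁻¹(a·γ + b − rₙ) + (1−δ)·∂_γψ·p(t)ᵀΘ̂⁻¹(a·γ + b − rₙ) + ((1−δ)/2)·((∂_γψ)²/ψ)·p(t)ᵀΘ̂⁻¹p(t) + (λγ + β)·∂_γψ + (1/2)·p(t)ᵀ(Σ̃_SΣ̃_Sᵀ)⁻¹p(t)·∂²_{γγ}ψ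 = 0. (The analytic core of Theorem 4 of the paper: the exponential-quadratic ansatz solves the reduced partial-information HJB PDE.) -/
open Matrix

/-- The derivative of the exponential of a quadratic polynomial. -/
theorem hasDerivAt_exp_quadratic (c d e z : ℝ) :
    HasDerivAt (fun x => Real.exp (c * x ^ 2 + d * x + e))
      (Real.exp (c * z ^ 2 + d * z + e) * (2 * c * z + d)) z := by
  have h := ((((hasDerivAt_pow 2 z).const_mul c).fun_add
    ((hasDerivAt_id' z).const_mul d)).add_const e).exp
  refine h.congr_deriv ?_
  push_cast
  ring

/-- Expansion of a symmetric quadratic form along a line. -/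
theorem quadratic_smul_add {n : ℕ} {M : Matrix (Fin n) (Fin n) ℝ} (hM : Mᵀ = M)
    (x : ℝ) (v w : Fin n → ℝ) :
    (x • v + w) ⬝ᵥ (M *ᵥ (x • v + w)) =
      x ^ 2 * (v ⬝ᵥ (M *ᵥ v)) + 2 * x * (v ⬝ᵥ (M *ᵥ w)) + w ⬝ᵥ (M *ᵥ w) := by
  have hswap : w ⬝ᵥ (M *ᵥ v) = v ⬝ᵥ (M *ᵥ w) := by
    rw [dotProduct_mulVec, ← mulVec_transpose, hM, dotProduct_comm]
  simp only [mulVec_add, mulVec_smul, dotProduct_add, add_dotProduct, dotProduct_smul,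
    smul_dotProduct, smul_eq_mul, hswap]
  ring

/-- Analytic core of Theorem 4 of the paper: the exponential-quadratic ansatz
`ψ(t,γ) = exp((f̄(t)/2)γ² + ḡ(t)γ + h̄(t))`, with `(f̄, ḡ, h̄)` solving the
partial-information ODE system with zero terminal conditions (where `p(t) = u + P(t)·a` is
the transposed Kalman gain), is positive, satisfies `ψ(T,·) = 1` and solves the reduced
partial-information HJB PDE. -/
theorem stmt_9 (n : ℕ) (a b u : Fin n → ℝ) (r σY lam β δ : ℝ)
    (hδ : 0 < δ) (hδ1 : δ ≠ 1) (hσY : 0 < σY)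
    (S Θ : Matrix (Fin n) (Fin n) ℝ) (hS : IsUnit S.det) (hΘ : Θ.PosDef)
    (T : ℝ) (P : ℝ → ℝ) (hPc : ContinuousOn P (Set.Icc 0 T))
    (fbar gbar hbar : ℝ → ℝ)
    (hfT : fbar T = 0) (hgT : gbar T = 0) (hhT : hbar T = 0)
    (hf : ∀ t ∈ Set.Icc (0:ℝ) T,
      HasDerivAt fbar
        (-(((1 - δ) * ((u + P t • a) ⬝ᵥ (Θ⁻¹ *ᵥ (u + P t • a))) +
              ((u + P t • a) ⬝ᵥ ((S * Sᵀ)⁻¹ *ᵥ (u + P t • a)))) * fbar t ^ 2 +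
            2 * ((1 - δ) * ((u + P t • a) ⬝ᵥ (Θ⁻¹ *ᵥ a)) + lam) * fbar t +
            (1 - δ) * (a ⬝ᵥ (Θ⁻¹ *ᵥ a)))) t)
    (hg : ∀ t ∈ Set.Icc (0:ℝ) T,
      HasDerivAt gbar
        (-(((1 - δ) * ((u + P t • a) ⬝ᵥ (Θ⁻¹ *ᵥ a)) + lam) * gbar t +
            ((1 - δ) * ((u + P t • a) ⬝ᵥ (Θ⁻¹ *ᵥ (b - r • (1 : Fin n → ℝ)))) + β) * fbar t +
            ((1 - δ) * ((u + P t • a) ⬝ᵥ (Θ⁻¹ *ᵥ (u + P t • a))) +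
                ((u + P t • a) ⬝ᵥ ((S * Sᵀ)⁻¹ *ᵥ (u + P t • a)))) * fbar t * gbar t +
            (1 - δ) * (a ⬝ᵥ (Θ⁻¹ *ᵥ (b - r • (1 : Fin n → ℝ)))))) t)
    (hh : ∀ t ∈ Set.Icc (0:ℝ) T,
      HasDerivAt hbar
        (-((1 - δ) * r +
            ((1 - δ) * ((u + P t • a) ⬝ᵥ (Θ⁻¹ *ᵥ (b - r • (1 : Fin n → ℝ)))) + β) * gbar t +
            (1 / 2) * ((u + P t • a) ⬝ᵥ ((S * Sᵀ)⁻¹ *ᵥ (u + P t • a))) * fbar t +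
            (1 / 2) *
              ((1 - δ) * ((u + P t • a) ⬝ᵥ (Θ⁻¹ *ᵥ (u + P t • a))) +
                ((u + P t • a) ⬝ᵥ ((S * Sᵀ)⁻¹ *ᵥ (u + P t • a)))) * gbar t ^ 2 +
            ((1 - δ) / 2) *
              ((b - r • (1 : Fin n → ℝ)) ⬝ᵥ (Θ⁻¹ *ᵥ (b - r • (1 : Fin n → ℝ)))))) t) :
    let ψ : ℝ → ℝ → ℝ := fun t γ => Real.exp (fbar t / 2 * γ ^ 2 + gbar t * γ + hbar t)
    ∀ t ∈ Set.Icc (0:ℝ) T, ∀ γ : ℝ,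
      0 < ψ t γ ∧ ψ T γ = 1 ∧
      deriv (fun s => ψ s γ) t + (1 - δ) * r * ψ t γ +
        ((1 - δ) / 2) * ψ t γ *
          ((γ • a + b - r • (1 : Fin n → ℝ)) ⬝ᵥ
            (Θ⁻¹ *ᵥ (γ • a + b - r • (1 : Fin n → ℝ)))) +
        (1 - δ) * deriv (fun z => ψ t z) γ *
          ((u + P t • a) ⬝ᵥ (Θ⁻¹ *ᵥ (γ • a + b - r • (1 : Fin n → ℝ)))) +
        ((1 - δ) / 2) * ((deriv (fun z => ψ t z) γ) ^ 2 / ψ t γ) *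
          ((u + P t • a) ⬝ᵥ (Θ⁻¹ *ᵥ (u + P t • a))) +
        (lam * γ + β) * deriv (fun z => ψ t z) γ +
        (1 / 2) * ((u + P t • a) ⬝ᵥ ((S * Sᵀ)⁻¹ *ᵥ (u + P t • a))) *
          deriv (deriv (fun z => ψ t z)) γ = 0 := by
  intro ψ t ht γ
  refine ⟨Real.exp_pos _, by simp [ψ, hfT, hgT, hhT], ?_⟩
  have hγ := hasDerivAt_exp_quadratic (fbar t / 2) (gbar t) (hbar t)
  have hψγ : deriv (fun z => ψ t z) = fun z => ψ t z * (fbar t * z + gbar t) := by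
    funext z
    rw [(hγ z).deriv]
    ring
  have hψγγ : deriv (fun z => ψ t z * (fbar t * z + gbar t)) γ =
      ψ t γ * ((fbar t * γ + gbar t) ^ 2 + fbar t) := by
    have hlin : HasDerivAt (fun z => fbar t * z + gbar t) (fbar t) γ := by
      simpa using ((hasDerivAt_id γ).const_mul (fbar t)).add_const (gbar t)
    refine ((hγ γ).fun_mul hlin).deriv.trans ?_
    simp only [ψ]
    ring
  have hψt := ((((hf t ht).div_const 2).mul_const (γ ^ 2)).fun_add
    ((hg t ht).mul_const γ)).fun_add (hh t ht) |>.exp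
  have hψ0 : ψ t γ ≠ 0 := (Real.exp_pos _).ne'
  have hsq : (ψ t γ * (fbar t * γ + gbar t)) ^ 2 / ψ t γ =
      ψ t γ * (fbar t * γ + gbar t) ^ 2 := by
    field_simp
  have hsymm : Θ⁻¹ᵀ = Θ⁻¹ := by simpa using hΘ.isHermitian.inv.eq
  have hψt' : deriv (fun s => ψ s γ) t = _ := hψt.deriv
  rw [hψγ, hψγγ, hsq, hψt', add_sub_assoc (γ • a), quadratic_smul_add hsymm,
    mulVec_add Θ⁻¹ (γ • a), mulVec_smul, dotProduct_add _ (γ • Θ⁻¹ *ᵥ a), dotProduct_smul]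
  simp only [smul_eq_mul, ψ]
  ring
end

section
/- Market coefficients as in the context, with Θ̂ symmetric positive definite and a ≠ 0. Let p : [0,T] → ℝⁿ be continuous and let f̄ : [0,T] → ℝ be a C¹ solution on [0,T] of f̄′(t) + A(t)·f̄(t)² + 2B(t)·f̄(t) + C = 0 with f̄(T) = 0, where A(t) = (1−δ)·p(t)ᵀΘ̂⁻¹p(t) + p(t)ᵀ(Σ̃_SΣ̃_Sᵀ)⁻¹p(t), B(t) = (1−δ)·p(t)ᵀΘ̂⁻¹a + λ, and C = (1−δ)·aᵀΘ̂⁻¹a. If δ ∈ (0,1) then f̄(t) > 0 for every t ∈ [0,T); if δ ∈ (1,+∞) then f̄(t) < 0 for every t ∈ [0,T). (Sign statement of Proposition 'sign of f̄' of the paper.) -/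
open Matrix

/-- If a function has negative derivative at each of its zeros in `[a, b]` and vanishes at `b`,
then it is positive on `[a, b)`. -/
theorem pos_of_hasDerivAt_neg_of_eq_zero {f f' : ℝ → ℝ} {a b : ℝ}
    (hf : ∀ t ∈ Set.Icc a b, HasDerivAt f (f' t) t)
    (hneg : ∀ t ∈ Set.Icc a b, f t = 0 → f' t < 0) (hb : f b = 0) :
    ∀ t ∈ Set.Ico a b, 0 < f t := by
  intro t ht
  by_contra! h
  have hle : ∀ x ∈ Set.Icc t b, f x ≤ 0 := by
    refine image_le_of_deriv_right_lt_deriv_boundary (f := f) (f' := f') (B := fun _ => 0)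
      (B' := fun _ => 0) (fun x hx => ?_) (fun x hx => ?_) h (fun x => hasDerivAt_const x 0)
      (fun x hx h0 => ?_)
    · exact (hf x ⟨ht.1.trans hx.1, hx.2⟩).continuousAt.continuousWithinAt
    · exact (hf x ⟨ht.1.trans hx.1, hx.2.le⟩).hasDerivWithinAt
    · exact hneg x ⟨ht.1.trans hx.1, hx.2.le⟩ h0
  have hmem : b ∈ Set.Icc a b := ⟨ht.1.trans ht.2.le, le_rfl⟩
  have hslope := (hasDerivAt_iff_tendsto_slope.1 (hf b hmem)).eventually_lt_const (hneg b hmem hb)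
  obtain ⟨x, hx, hxt⟩ := ((hslope.filter_mono (nhdsLT_le_nhdsNE b)).and
    (Ioo_mem_nhdsLT ht.2)).exists
  rw [slope_def_field, hb, sub_zero] at hx
  exact hx.not_ge (div_nonneg_of_nonpos (hle x ⟨hxt.1.le, hxt.2.le⟩) (sub_nonpos.2 hxt.2.le))

/-- Sign of `f̄` (Proposition 8 of the paper): if `f̄` is a C¹ solution on `[0,T]` of the
partial-information Riccati equation `f̄′ + A(t)f̄² + 2B(t)f̄ + C = 0` with `f̄(T) = 0`,
where `A(t) = (1−δ)p(t)ᵀΘ̂⁻¹p(t) + p(t)ᵀ(Σ̃_SΣ̃_Sᵀ)⁻¹p(t)`, `B(t) = (1−δ)p(t)ᵀΘ̂⁻¹a + λ`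
and `C = (1−δ)aᵀΘ̂⁻¹a`, then `f̄ > 0` on `[0,T)` when `δ ∈ (0,1)` and `f̄ < 0` on `[0,T)`
when `δ ∈ (1,∞)`. -/
theorem stmt_10 (n : ℕ) (a : Fin n → ℝ) (ha : a ≠ 0) (lam δ : ℝ)
    (hδ : 0 < δ) (hδ1 : δ ≠ 1)
    (S Θ : Matrix (Fin n) (Fin n) ℝ) (hS : IsUnit S.det) (hSS : (S * Sᵀ).PosDef)
    (hΘ : Θ.PosDef)
    (T : ℝ) (hT : 0 < T)
    (p : ℝ → Fin n → ℝ) (hp : ContinuousOn p (Set.Icc 0 T))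
    (fbar : ℝ → ℝ)
    (hf : ∀ t ∈ Set.Icc (0:ℝ) T,
      HasDerivAt fbar
        (-(((1 - δ) * (p t ⬝ᵥ (Θ⁻¹ *ᵥ p t)) + (p t ⬝ᵥ ((S * Sᵀ)⁻¹ *ᵥ p t))) * fbar t ^ 2 +
            2 * ((1 - δ) * (p t ⬝ᵥ (Θ⁻¹ *ᵥ a)) + lam) * fbar t +
            (1 - δ) * (a ⬝ᵥ (Θ⁻¹ *ᵥ a)))) t)
    (hfT : fbar T = 0) :
    (δ ∈ Set.Ioo (0:ℝ) 1 → ∀ t ∈ Set.Ico (0:ℝ) T, 0 < fbar t) ∧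
    (1 < δ → ∀ t ∈ Set.Ico (0:ℝ) T, fbar t < 0) := by
  have hC : 0 < a ⬝ᵥ (Θ⁻¹ *ᵥ a) := by
    simpa using hΘ.inv.dotProduct_mulVec_pos ha
  refine ⟨fun h => pos_of_hasDerivAt_neg_of_eq_zero hf (fun t _ h0 => ?_) hfT, fun h t ht => ?_⟩
  · have := mul_pos (sub_pos.2 h.2) hC
    simpa [h0] using this
  · refine neg_pos.1 (pos_of_hasDerivAt_neg_of_eq_zero (f := fun s => -fbar s)
      (fun s hs => (hf s hs).fun_neg) (fun s _ h0 => ?_) (by simp [hfT]) t ht)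
    have := mul_neg_of_neg_of_pos (sub_neg.2 h) hC
    simpa [neg_eq_zero.1 h0] using this
end
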